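/- Let μ be the probability measure on ℝ² assigning mass 1/3 to each of the points (0,−1), (2,0) and (1,1). Then there is no nonempty compact convex set A ⊆ ℝ² such that for every unit vector u ∈ S¹ the support function value h_A(u) := sup{⟨u,v⟩ : v ∈ A} is a median of the pushforward of μ under x ↦ ⟨u,x⟩. (Consequently, the fuzzy random variable taking the values I_{(0,−1)}, I_{(2,0)}, I_{(1,1)} each with probability 1/3 has no support median: already in the crisp bivariate case a simultaneous directional median need not exist.) -/

import Mathlib

open MeasureTheory

/-- The discrete probability measure on ℝ² giving mass 1/3 to each of
(0,−1), (2,0) and (1,1). -/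
noncomputable def muThreePoints : Measure (ℝ × ℝ) :=
  (3 : ENNReal)⁻¹ •
    (Measure.dirac ((0 : ℝ), (-1 : ℝ)) + Measure.dirac ((2 : ℝ), (0 : ℝ)) +
      Measure.dirac ((1 : ℝ), (1 : ℝ)))

/-- A measurable set of `muThreePoints`-mass at least `1/2` contains two of the three atoms. -/
theorem two_atoms_mem_of_half_le_muThreePoints {S : Set (ℝ × ℝ)} (hS : MeasurableSet S)
    (h : 1/2 ≤ muThreePoints S) :
    ((0, -1) ∈ S ∧ (2, 0) ∈ S) ∨ ((0, -1) ∈ S ∧ (1, 1) ∈ S) ∨ ((2, 0) ∈ S ∧ (1, 1) ∈ S) := by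
  have third_lt_half : ¬ (2 : ENNReal)⁻¹ ≤ 3⁻¹ := by
    rw [ENNReal.inv_le_inv]
    norm_num
  by_cases h₁ : ((0, -1) : ℝ × ℝ) ∈ S <;> by_cases h₂ : ((2, 0) : ℝ × ℝ) ∈ S <;>
    by_cases h₃ : ((1, 1) : ℝ × ℝ) ∈ S <;>
    simp_all [muThreePoints, Measure.dirac_apply' _ hS]

/-- If a median of the projection of `muThreePoints` onto `u` is the support value of a compact
set `A`, then every point of `A` projects below at least two of the three atoms. -/
theorem inner_le_two_atoms_of_half_le {A : Set (ℝ × ℝ)} (hA : IsCompact A) {u v : ℝ × ℝ}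
    (hv : v ∈ A)
    (h : 1/2 ≤ muThreePoints
      {x : ℝ × ℝ | sSup ((fun v : ℝ × ℝ => u.1 * v.1 + u.2 * v.2) '' A) ≤
        u.1 * x.1 + u.2 * x.2}) :
    (u.1 * v.1 + u.2 * v.2 ≤ -u.2 ∧ u.1 * v.1 + u.2 * v.2 ≤ u.1 * 2) ∨
    (u.1 * v.1 + u.2 * v.2 ≤ -u.2 ∧ u.1 * v.1 + u.2 * v.2 ≤ u.1 + u.2) ∨
    (u.1 * v.1 + u.2 * v.2 ≤ u.1 * 2 ∧ u.1 * v.1 + u.2 * v.2 ≤ u.1 + u.2) := by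
  have hle : u.1 * v.1 + u.2 * v.2 ≤ sSup ((fun v : ℝ × ℝ => u.1 * v.1 + u.2 * v.2) '' A) :=
    le_csSup (hA.image (by fun_prop)).bddAbove ⟨v, hv, rfl⟩
  have hatoms := two_atoms_mem_of_half_le_muThreePoints
    (measurableSet_le measurable_const (by fun_prop)) h
  simp only [Set.mem_ofPred_eq, mul_zero, mul_one, mul_neg, zero_add, add_zero] at hatoms
  exact hatoms.imp (And.imp hle.trans hle.trans)
    (Or.imp (And.imp hle.trans hle.trans) (And.imp hle.trans hle.trans))

/-- There is no nonempty compact convex set `A ⊆ ℝ²` whose support function value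
`h_A(u) = sup {⟨u,v⟩ : v ∈ A}` is, for every Euclidean unit vector `u`, a median of the
projection `x ↦ ⟨u,x⟩` of the three-point distribution `muThreePoints`. -/
theorem no_simultaneous_directional_median :
    ¬ ∃ A : Set (ℝ × ℝ), A.Nonempty ∧ IsCompact A ∧ Convex ℝ A ∧
      ∀ u : ℝ × ℝ, u.1 ^ 2 + u.2 ^ 2 = 1 →
        (1/2 ≤ muThreePoints
            {x : ℝ × ℝ | u.1 * x.1 + u.2 * x.2 ≤
              sSup ((fun v : ℝ × ℝ => u.1 * v.1 + u.2 * v.2) '' A)} ∧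
         1/2 ≤ muThreePoints
            {x : ℝ × ℝ | sSup ((fun v : ℝ × ℝ => u.1 * v.1 + u.2 * v.2) '' A) ≤
              u.1 * x.1 + u.2 * x.2}) := by
  rintro ⟨A, ⟨v, hv⟩, hA, -, hmed⟩
  have hproj (u : ℝ × ℝ) (hu : u.1 ^ 2 + u.2 ^ 2 = 1) :=
    inner_le_two_atoms_of_half_le hA hv (hmed u hu).2
  have hright := hproj (1, 0) (by norm_num)
  have hup := hproj (0, 1) (by norm_num)
  have hdiag := hproj (-3/5, -4/5) (by norm_num)
  norm_num at hright hup hdiag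
  have hx : v.1 ≤ 1 := by grind
  have hy : v.2 ≤ 0 := by grind
  grind
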